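/- Let κ ∈ ℂ∖{0} and let F, G: ℂ → ℂ be holomorphic. Consider the Zakrzewski-type bracket on ℂ^{2n} defined below. For n = 1 this bracket always satisfies the Jacobi identity. For n ≥ 2, it satisfies the Jacobi identity on all polynomial (equivalently, all twice continuously differentiable) functions if and only if F(t)F'(t) + G(t)(F(t) − F'(t) t) = t for all t ∈ ℂ. -/

import Mathlib

open Matrix BigOperators

noncomputable section

attribute [local instance] Matrix.normedAddCommGroup Matrix.normedSpace

/-- complex-valued sign of an integer, with `csgn 0 = 0`. -/
def csgn (m : ℤ) : ℂ := (m.sign : ℂ)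

/-- Kronecker delta with values in `ℂ`. -/
def cdelta {K : Type*} [DecidableEq K] (i j : K) : ℂ := if i = j then 1 else 0

/-- `ℂ^{2n} = ℂⁿ × ℂⁿ` with coordinates `(a,b)`. -/
abbrev ZSp (n : ℕ) : Type := (Fin n → ℂ) × (Fin n → ℂ)

/-- coordinate direction for `a_i`. -/
def za (n : ℕ) (i : Fin n) : ZSp n := (Pi.single i 1, 0)

/-- coordinate direction for `b_i`. -/
def zb (n : ℕ) (i : Fin n) : ZSp n := (0, Pi.single i 1)

/-- `{a_i, a_j}` for the Zakrzewski-type bracket. -/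
def zaa (n : ℕ) (κ : ℂ) (y : ZSp n) (i j : Fin n) : ℂ :=
  κ / 2 * csgn (((i : ℕ) : ℤ) - ((j : ℕ) : ℤ)) * y.1 i * y.1 j

/-- `{b_i, b_j}` for the Zakrzewski-type bracket. -/
def zbb (n : ℕ) (κ : ℂ) (y : ZSp n) (i j : Fin n) : ℂ :=
  -(κ / 2) * csgn (((i : ℕ) : ℤ) - ((j : ℕ) : ℤ)) * y.2 i * y.2 j

/-- `{a_i, b_l}` for the Zakrzewski-type bracket with functions `F`, `G` of `t = Σ_r a_r b_r`. -/
def zab (n : ℕ) (κ : ℂ) (F G : ℂ → ℂ) (y : ZSp n) (i l : Fin n) : ℂ :=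
  κ / 2 * cdelta i l * F (∑ r : Fin n, y.1 r * y.2 r)
    - κ / 2 * G (∑ r : Fin n, y.1 r * y.2 r) * y.1 i * y.2 l
    + κ / 2 * cdelta i l *
        ∑ r : Fin n, csgn (((r : ℕ) : ℤ) - ((i : ℕ) : ℤ)) * y.1 r * y.2 r

/-- The Zakrzewski-type bivector bracket on `ℂ^{2n}`. -/
def brZ (n : ℕ) (κ : ℂ) (F G : ℂ → ℂ) (F₁ F₂ : ZSp n → ℂ) (y : ZSp n) : ℂ :=
  ∑ i : Fin n, ∑ j : Fin n,
    (zaa n κ y i j * fderiv ℂ F₁ y (za n i) * fderiv ℂ F₂ y (za n j)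
      + zab n κ F G y i j *
          (fderiv ℂ F₁ y (za n i) * fderiv ℂ F₂ y (zb n j)
            - fderiv ℂ F₂ y (za n i) * fderiv ℂ F₁ y (zb n j))
      + zbb n κ y i j * fderiv ℂ F₁ y (zb n i) * fderiv ℂ F₂ y (zb n j))

section Bivector

variable {E ι : Type*} [NormedAddCommGroup E] [NormedSpace ℂ E] [Fintype ι]

/-- The bracket of the bivector with components `P α β` with respect to the vectors `e α`. -/
def bivectorBracket (e : ι → E) (P : ι → ι → E → ℂ) (f g : E → ℂ) (y : E) : ℂ :=
  ∑ α, ∑ β, P α β y * fderiv ℂ f y (e α) * fderiv ℂ g y (e β)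

/-- The Hamiltonian vector of the coordinate with index `α`. -/
def coordHam (e : ι → E) (P : ι → ι → E → ℂ) (α : ι) (y : E) : E :=
  ∑ δ, P α δ y • e δ

/-- The Hamiltonian vector of the function `f`. -/
def hamVec (e : ι → E) (P : ι → ι → E → ℂ) (f : E → ℂ) (y : E) : E :=
  ∑ α, fderiv ℂ f y (e α) • coordHam e P α y

/-- The Jacobiator of the coordinates with indices `α`, `β`, `γ`. -/
def coordJacobiator (e : ι → E) (P : ι → ι → E → ℂ) (α β γ : ι) (y : E) : ℂ :=
  fderiv ℂ (P β γ) y (coordHam e P α y) + fderiv ℂ (P γ α) y (coordHam e P β y)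
    + fderiv ℂ (P α β) y (coordHam e P γ y)

lemma coordJacobiator_cycle (e : ι → E) (P : ι → ι → E → ℂ) (α β γ : ι) (y : E) :
    coordJacobiator e P α β γ y = coordJacobiator e P β γ α y := by
  unfold coordJacobiator
  ring

lemma bivectorBracket_eq_fderiv_hamVec (e : ι → E) (P : ι → ι → E → ℂ) (f g : E → ℂ) (y : E) :
    bivectorBracket e P f g y = fderiv ℂ g y (hamVec e P f y) := by
  simp only [bivectorBracket, hamVec, coordHam, map_sum, map_smul, smul_eq_mul, Finset.mul_sum]
  exact Finset.sum_congr rfl fun α _ => Finset.sum_congr rfl fun β _ => by ring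

lemma fderiv_bivectorBracket {e : ι → E} {P : ι → ι → E → ℂ}
    (hP : ∀ α β, Differentiable ℂ (P α β)) (hanti : ∀ α β y, P α β y = -P β α y)
    {g h : E → ℂ} (hg : ContDiff ℂ 2 g) (hh : ContDiff ℂ 2 h) (y v : E) :
    fderiv ℂ (bivectorBracket e P g h) y v =
      (∑ β, ∑ γ, fderiv ℂ g y (e β) * fderiv ℂ h y (e γ) * fderiv ℂ (P β γ) y v)
        - fderiv ℂ (fderiv ℂ g) y v (hamVec e P h y)
        + fderiv ℂ (fderiv ℂ h) y v (hamVec e P g y) := by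
  have hD : ∀ {k : E → ℂ}, ContDiff ℂ 2 k → ∀ w : E,
      HasFDerivAt (fun z => fderiv ℂ k z w) ((fderiv ℂ (fderiv ℂ k) y).flip w) y := by
    intro k hk w
    have h1 : DifferentiableAt ℂ (fderiv ℂ k) y :=
      ((hk.fderiv_right (m := 1) (by norm_num)).differentiable (by norm_num)) y
    simpa using h1.hasFDerivAt.clm_apply (hasFDerivAt_const w y)
  have key : HasFDerivAt (bivectorBracket e P g h) _ y :=
    HasFDerivAt.fun_sum fun β (_ : β ∈ Finset.univ) =>
      HasFDerivAt.fun_sum fun γ (_ : γ ∈ Finset.univ) =>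
        (((hP β γ y).hasFDerivAt.mul (hD hg (e β))).mul (hD hh (e γ)))
  have e1 : fderiv ℂ (fderiv ℂ g) y v (hamVec e P h y) =
      -∑ β, ∑ γ, P β γ y * fderiv ℂ (fderiv ℂ g) y v (e β) * fderiv ℂ h y (e γ) := by
    simp only [hamVec, coordHam, map_sum, map_smul, smul_eq_mul, Finset.mul_sum]
    rw [Finset.sum_comm, ← Finset.sum_neg_distrib]
    refine Finset.sum_congr rfl fun β _ => ?_
    rw [← Finset.sum_neg_distrib]
    refine Finset.sum_congr rfl fun γ _ => ?_
    rw [hanti γ β]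
    ring
  have e2 : fderiv ℂ (fderiv ℂ h) y v (hamVec e P g y) =
      ∑ β, ∑ γ, P β γ y * fderiv ℂ g y (e β) * fderiv ℂ (fderiv ℂ h) y v (e γ) := by
    simp only [hamVec, coordHam, map_sum, map_smul, smul_eq_mul, Finset.mul_sum]
    exact Finset.sum_congr rfl fun β _ => Finset.sum_congr rfl fun γ _ => by ring
  rw [key.fderiv, e1, e2, sub_neg_eq_add, ← Finset.sum_add_distrib, ← Finset.sum_add_distrib]
  simp only [_root_.sum_apply]
  refine Finset.sum_congr rfl fun β _ => ?_
  rw [← Finset.sum_add_distrib, ← Finset.sum_add_distrib]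
  refine Finset.sum_congr rfl fun γ _ => ?_
  simp
  ring

/-- The Jacobiator of an antisymmetric bivector is a first-order operator in each argument. -/
lemma bivectorBracket_jacobiator {e : ι → E} {P : ι → ι → E → ℂ}
    (hP : ∀ α β, Differentiable ℂ (P α β)) (hanti : ∀ α β y, P α β y = -P β α y)
    {f g h : E → ℂ} (hf : ContDiff ℂ 2 f) (hg : ContDiff ℂ 2 g) (hh : ContDiff ℂ 2 h) (y : E) :
    bivectorBracket e P f (bivectorBracket e P g h) y
        + bivectorBracket e P g (bivectorBracket e P h f) y
        + bivectorBracket e P h (bivectorBracket e P f g) y =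
      ∑ α, ∑ β, ∑ γ, fderiv ℂ f y (e α) * fderiv ℂ g y (e β) * fderiv ℂ h y (e γ)
        * coordJacobiator e P α β γ y := by
  have hsymm : ∀ {k : E → ℂ}, ContDiff ℂ 2 k → ∀ v w : E,
      fderiv ℂ (fderiv ℂ k) y v w = fderiv ℂ (fderiv ℂ k) y w v := fun hk v w =>
    (hk.contDiffAt.isSymmSndFDerivAt (by simp)) v w
  rw [bivectorBracket_eq_fderiv_hamVec e P f, bivectorBracket_eq_fderiv_hamVec e P g (_),
    bivectorBracket_eq_fderiv_hamVec e P h (_), fderiv_bivectorBracket hP hanti hg hh,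
    fderiv_bivectorBracket hP hanti hh hf, fderiv_bivectorBracket hP hanti hf hg,
    hsymm hf (hamVec e P h y), hsymm hg (hamVec e P h y), hsymm hh (hamVec e P g y)]
  have e1 : ∑ β, ∑ γ, fderiv ℂ g y (e β) * fderiv ℂ h y (e γ)
        * fderiv ℂ (P β γ) y (hamVec e P f y) =
      ∑ α, ∑ β, ∑ γ, fderiv ℂ f y (e α) * fderiv ℂ g y (e β) * fderiv ℂ h y (e γ)
        * fderiv ℂ (P β γ) y (coordHam e P α y) := by
    simp only [hamVec, map_sum, map_smul, smul_eq_mul, Finset.mul_sum]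
    symm
    rw [Finset.sum_comm]
    refine Finset.sum_congr rfl fun β _ => ?_
    rw [Finset.sum_comm]
    exact Finset.sum_congr rfl fun γ _ => Finset.sum_congr rfl fun α _ => by ring
  have e2 : ∑ γ, ∑ α, fderiv ℂ h y (e γ) * fderiv ℂ f y (e α)
        * fderiv ℂ (P γ α) y (hamVec e P g y) =
      ∑ α, ∑ β, ∑ γ, fderiv ℂ f y (e α) * fderiv ℂ g y (e β) * fderiv ℂ h y (e γ)
        * fderiv ℂ (P γ α) y (coordHam e P β y) := by
    simp only [hamVec, map_sum, map_smul, smul_eq_mul, Finset.mul_sum]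
    rw [Finset.sum_comm]
    refine Finset.sum_congr rfl fun α _ => ?_
    rw [Finset.sum_comm]
    exact Finset.sum_congr rfl fun β _ => Finset.sum_congr rfl fun γ _ => by ring
  have e3 : ∑ α, ∑ β, fderiv ℂ f y (e α) * fderiv ℂ g y (e β)
        * fderiv ℂ (P α β) y (hamVec e P h y) =
      ∑ α, ∑ β, ∑ γ, fderiv ℂ f y (e α) * fderiv ℂ g y (e β) * fderiv ℂ h y (e γ)
        * fderiv ℂ (P α β) y (coordHam e P γ y) := by
    simp only [hamVec, map_sum, map_smul, smul_eq_mul, Finset.mul_sum]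
    exact Finset.sum_congr rfl fun α _ => Finset.sum_congr rfl fun β _ =>
      Finset.sum_congr rfl fun γ _ => by ring
  simp only [coordJacobiator, mul_add, Finset.sum_add_distrib]
  rw [← e1, ← e2, ← e3]
  ring

end Bivector

section Zakrzewski

variable {n : ℕ} {κ : ℂ} {F G : ℂ → ℂ}

/-- The coordinate directions of `ZSp n`. -/
def zdir (n : ℕ) : Fin n ⊕ Fin n → ZSp n := Sum.elim (za n) (zb n)

lemma zdir_inl (i : Fin n) : zdir n (.inl i) = za n i := rfl

lemma zdir_inr (i : Fin n) : zdir n (.inr i) = zb n i := rfl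

/-- The components of the Zakrzewski-type bivector. -/
def zbiv (n : ℕ) (κ : ℂ) (F G : ℂ → ℂ) : Fin n ⊕ Fin n → Fin n ⊕ Fin n → ZSp n → ℂ
  | .inl i, .inl j => fun y => zaa n κ y i j
  | .inl i, .inr l => fun y => zab n κ F G y i l
  | .inr l, .inl i => fun y => -zab n κ F G y i l
  | .inr i, .inr j => fun y => zbb n κ y i j

/-- The sum `Σ_r a_r b_r`. -/
def zdot (y : ZSp n) : ℂ := ∑ r, y.1 r * y.2 r

/-- The signed sum `Σ_r sgn(r - i) a_r b_r`. -/
def zsgnDot (i : Fin n) (y : ZSp n) : ℂ :=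
  ∑ r : Fin n, csgn (((r : ℕ) : ℤ) - ((i : ℕ) : ℤ)) * y.1 r * y.2 r

lemma csgn_swap (i j : ℤ) : csgn (i - j) = -csgn (j - i) := by
  rw [← neg_sub j i, csgn, csgn, Int.sign_neg]
  push_cast
  rfl

lemma csgn_self (i : ℤ) : csgn (i - i) = 0 := by simp [csgn]

/-- For `i ≠ j`, the product formula for signs of three integers. -/
lemma csgn_triple {i j : ℤ} (h : i ≠ j) (r : ℤ) :
    csgn (r - j) * csgn (i - r) + csgn (i - j) * (csgn (r - i) - csgn (r - j)) = -1 := by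
  have hz : (r - j).sign * (i - r).sign + (i - j).sign * ((r - i).sign - (r - j).sign) = -1 := by
    have hs : ∀ m : ℤ, (0 < m ∧ m.sign = 1) ∨ (m = 0 ∧ m.sign = 0) ∨ (m < 0 ∧ m.sign = -1) := by
      intro m
      rcases lt_trichotomy m 0 with hm | hm | hm
      · exact Or.inr (Or.inr ⟨hm, Int.sign_eq_neg_one_of_neg hm⟩)
      · exact Or.inr (Or.inl ⟨hm, by simp [hm]⟩)
      · exact Or.inl ⟨hm, Int.sign_eq_one_of_pos hm⟩
    rcases hs (r - j) with ⟨h1, e1⟩ | ⟨h1, e1⟩ | ⟨h1, e1⟩ <;>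
    rcases hs (i - r) with ⟨h2, e2⟩ | ⟨h2, e2⟩ | ⟨h2, e2⟩ <;>
    rcases hs (i - j) with ⟨h3, e3⟩ | ⟨h3, e3⟩ | ⟨h3, e3⟩ <;>
    rcases hs (r - i) with ⟨h4, e4⟩ | ⟨h4, e4⟩ | ⟨h4, e4⟩ <;>
    first
      | (exfalso; omega)
      | (rw [e1, e2, e3, e4]; norm_num)
  unfold csgn
  exact_mod_cast hz

lemma zbiv_antisymm (α β : Fin n ⊕ Fin n) (y : ZSp n) :
    zbiv n κ F G α β y = -zbiv n κ F G β α y := by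
  rcases α with i | i <;> rcases β with j | j <;>
    simp only [zbiv, zaa, zbb, neg_neg]
  all_goals
    rw [csgn_swap]
    ring

lemma brZ_eq_bivectorBracket (n : ℕ) (κ : ℂ) (F G : ℂ → ℂ) :
    brZ n κ F G = bivectorBracket (zdir n) (zbiv n κ F G) := by
  funext F₁ F₂ y
  simp only [brZ, bivectorBracket, Fintype.sum_sum_type, zdir, zbiv, Sum.elim_inl, Sum.elim_inr,
    Finset.sum_add_distrib, mul_sub, Finset.sum_sub_distrib]
  have e : ∑ l, ∑ i, -zab n κ F G y i l * fderiv ℂ F₁ y (zb n l) * fderiv ℂ F₂ y (za n i) =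
      -∑ i, ∑ l, zab n κ F G y i l * (fderiv ℂ F₂ y (za n i) * fderiv ℂ F₁ y (zb n l)) := by
    rw [Finset.sum_comm, ← Finset.sum_neg_distrib]
    refine Finset.sum_congr rfl fun i _ => ?_
    rw [← Finset.sum_neg_distrib]
    exact Finset.sum_congr rfl fun l _ => by ring
  rw [e]
  simp only [mul_assoc]
  ring

lemma coordHam_inl (i : Fin n) (y : ZSp n) :
    coordHam (zdir n) (zbiv n κ F G) (.inl i) y = (zaa n κ y i, zab n κ F G y i) := by
  ext j <;>
  simp [coordHam, zdir, zbiv, za, zb, Prod.fst_sum, Prod.snd_sum, Pi.single_apply]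

lemma coordHam_inr (l : Fin n) (y : ZSp n) :
    coordHam (zdir n) (zbiv n κ F G) (.inr l) y =
      (fun i => -zab n κ F G y i l, zbb n κ y l) := by
  ext j <;>
  simp [coordHam, zdir, zbiv, za, zb, Prod.fst_sum, Prod.snd_sum, Pi.single_apply]

lemma hasFDerivAt_fst_apply (i : Fin n) (y : ZSp n) :
    HasFDerivAt (fun z : ZSp n => z.1 i)
      ((ContinuousLinearMap.proj i).comp (ContinuousLinearMap.fst ℂ (Fin n → ℂ) (Fin n → ℂ))) y :=
  ((ContinuousLinearMap.proj (R := ℂ) (φ := fun _ : Fin n => ℂ) i).comp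
    (ContinuousLinearMap.fst ℂ (Fin n → ℂ) (Fin n → ℂ))).hasFDerivAt

lemma hasFDerivAt_snd_apply (i : Fin n) (y : ZSp n) :
    HasFDerivAt (fun z : ZSp n => z.2 i)
      ((ContinuousLinearMap.proj i).comp (ContinuousLinearMap.snd ℂ (Fin n → ℂ) (Fin n → ℂ))) y :=
  ((ContinuousLinearMap.proj (R := ℂ) (φ := fun _ : Fin n => ℂ) i).comp
    (ContinuousLinearMap.snd ℂ (Fin n → ℂ) (Fin n → ℂ))).hasFDerivAt

lemma differentiable_zdot : Differentiable ℂ (zdot : ZSp n → ℂ) := by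
  unfold zdot
  fun_prop

lemma differentiable_zsgnDot (i : Fin n) : Differentiable ℂ (zsgnDot i) := by
  unfold zsgnDot
  fun_prop

lemma fderiv_zdot (y v : ZSp n) :
    fderiv ℂ zdot y v = ∑ r, (v.1 r * y.2 r + y.1 r * v.2 r) := by
  have key : HasFDerivAt (zdot : ZSp n → ℂ) _ y :=
    HasFDerivAt.fun_sum fun r (_ : r ∈ Finset.univ) =>
      (hasFDerivAt_fst_apply r y).mul (hasFDerivAt_snd_apply r y)
  rw [key.fderiv, _root_.sum_apply]
  refine Finset.sum_congr rfl fun r _ => ?_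
  simp
  ring

lemma fderiv_zsgnDot (i : Fin n) (y v : ZSp n) :
    fderiv ℂ (zsgnDot i) y v = ∑ r : Fin n, csgn (((r : ℕ) : ℤ) - ((i : ℕ) : ℤ)) *
      (v.1 r * y.2 r + y.1 r * v.2 r) := by
  have key : HasFDerivAt (zsgnDot i) _ y :=
    HasFDerivAt.fun_sum fun r (_ : r ∈ Finset.univ) =>
      ((hasFDerivAt_fst_apply r y).const_mul _).mul (hasFDerivAt_snd_apply r y)
  rw [key.fderiv, _root_.sum_apply]
  refine Finset.sum_congr rfl fun r _ => ?_
  simp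
  ring

lemma zab_eq (y : ZSp n) (i l : Fin n) :
    zab n κ F G y i l = κ / 2 * (cdelta i l * (F (zdot y) + zsgnDot i y)
      - G (zdot y) * y.1 i * y.2 l) := by
  simp only [zab, zdot, zsgnDot]
  ring

lemma differentiable_zbiv (hF : Differentiable ℂ F) (hG : Differentiable ℂ G)
    (α β : Fin n ⊕ Fin n) : Differentiable ℂ (zbiv n κ F G α β) := by
  have hab : ∀ i l, Differentiable ℂ fun y => zab n κ F G y i l := by
    intro i l
    unfold zab
    fun_prop
  rcases α with i | i <;> rcases β with j | j
  · unfold zbiv zaa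
    fun_prop
  · exact hab i j
  · exact (hab j i).neg
  · unfold zbiv zbb
    fun_prop

lemma fderiv_zbiv_inl_inl (i j : Fin n) (y v : ZSp n) :
    fderiv ℂ (zbiv n κ F G (.inl i) (.inl j)) y v =
      κ / 2 * csgn (((i : ℕ) : ℤ) - ((j : ℕ) : ℤ)) * (v.1 i * y.1 j + y.1 i * v.1 j) := by
  have key : HasFDerivAt (zbiv n κ F G (.inl i) (.inl j)) _ y :=
    ((hasFDerivAt_fst_apply i y).const_mul _).mul (hasFDerivAt_fst_apply j y)
  rw [key.fderiv]
  simp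
  ring

lemma fderiv_zbiv_inr_inr (i j : Fin n) (y v : ZSp n) :
    fderiv ℂ (zbiv n κ F G (.inr i) (.inr j)) y v =
      -(κ / 2) * csgn (((i : ℕ) : ℤ) - ((j : ℕ) : ℤ)) * (v.2 i * y.2 j + y.2 i * v.2 j) := by
  have key : HasFDerivAt (zbiv n κ F G (.inr i) (.inr j)) _ y :=
    ((hasFDerivAt_snd_apply i y).const_mul _).mul (hasFDerivAt_snd_apply j y)
  rw [key.fderiv]
  simp
  ring

lemma fderiv_zbiv_inl_inr (hF : Differentiable ℂ F) (hG : Differentiable ℂ G)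
    (i l : Fin n) (y v : ZSp n) :
    fderiv ℂ (zbiv n κ F G (.inl i) (.inr l)) y v =
      κ / 2 * (cdelta i l * (deriv F (zdot y) * fderiv ℂ zdot y v + fderiv ℂ (zsgnDot i) y v)
        - deriv G (zdot y) * fderiv ℂ zdot y v * y.1 i * y.2 l
        - G (zdot y) * (v.1 i * y.2 l + y.1 i * v.2 l)) := by
  have hfun : zbiv n κ F G (.inl i) (.inr l) = fun y => κ / 2 *
      (cdelta i l * (F (zdot y) + zsgnDot i y) - G (zdot y) * y.1 i * y.2 l) :=
    funext fun y => zab_eq y i l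
  have hdot := (differentiable_zdot y).hasFDerivAt
  have key := (((((hF (zdot y)).hasDerivAt.comp_hasFDerivAt y hdot).add
    (differentiable_zsgnDot i y).hasFDerivAt).const_mul (cdelta i l)).sub
    ((((hG (zdot y)).hasDerivAt.comp_hasFDerivAt y hdot).mul
      (hasFDerivAt_fst_apply i y)).mul (hasFDerivAt_snd_apply l y))).const_mul (κ / 2)
  rw [hfun]
  refine (congrArg (fun L : ZSp n →L[ℂ] ℂ => L v) key.fderiv).trans ?_
  simp only [_root_.smul_apply, _root_.sub_apply, _root_.add_apply,
    ContinuousLinearMap.comp_apply, ContinuousLinearMap.proj_apply, ContinuousLinearMap.coe_fst',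
    ContinuousLinearMap.coe_snd', Function.comp_apply, Pi.mul_apply, smul_eq_mul]
  ring

lemma fderiv_zbiv_inr_inl (i l : Fin n) (y v : ZSp n) :
    fderiv ℂ (zbiv n κ F G (.inr l) (.inl i)) y v =
      -fderiv ℂ (zbiv n κ F G (.inl i) (.inr l)) y v := by
  have h : zbiv n κ F G (.inr l) (.inl i) = -zbiv n κ F G (.inl i) (.inr l) :=
    funext fun y => zbiv_antisymm _ _ y
  rw [h, fderiv_neg]
  rfl

lemma fderiv_zdot_coordHam_inl (i : Fin n) (y : ZSp n) :
    fderiv ℂ zdot y (coordHam (zdir n) (zbiv n κ F G) (.inl i) y) =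
      κ / 2 * y.1 i * (F (zdot y) - G (zdot y) * zdot y) := by
  have e : ∀ r : Fin n, zaa n κ y i r * y.2 r + y.1 r * zab n κ F G y i r =
      κ / 2 * (y.1 i * (-(csgn (((r : ℕ) : ℤ) - ((i : ℕ) : ℤ)) * y.1 r * y.2 r))
        + cdelta i r * (y.1 r * (F (zdot y) + zsgnDot i y))
        - y.1 i * G (zdot y) * (y.1 r * y.2 r)) := by
    intro r
    rw [zab_eq, zaa, csgn_swap]
    ring
  rw [fderiv_zdot, coordHam_inl, Finset.sum_congr rfl fun r _ => e r, ← Finset.mul_sum,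
    Finset.sum_sub_distrib, Finset.sum_add_distrib, ← Finset.mul_sum, ← Finset.mul_sum,
    Finset.sum_neg_distrib, ← zdot, ← zsgnDot]
  simp [cdelta]
  ring

lemma fderiv_zdot_coordHam_inr (l : Fin n) (y : ZSp n) :
    fderiv ℂ zdot y (coordHam (zdir n) (zbiv n κ F G) (.inr l) y) =
      -(κ / 2 * y.2 l * (F (zdot y) - G (zdot y) * zdot y)) := by
  have e : ∀ r : Fin n, -zab n κ F G y r l * y.2 r + y.1 r * zbb n κ y l r =
      κ / 2 * (y.2 l * (csgn (((r : ℕ) : ℤ) - ((l : ℕ) : ℤ)) * y.1 r * y.2 r)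
        - cdelta r l * (y.2 r * (F (zdot y) + zsgnDot r y))
        + y.2 l * G (zdot y) * (y.1 r * y.2 r)) := by
    intro r
    rw [zab_eq, zbb, csgn_swap]
    ring
  rw [fderiv_zdot, coordHam_inr, Finset.sum_congr rfl fun r _ => e r, ← Finset.mul_sum,
    Finset.sum_add_distrib, Finset.sum_sub_distrib, ← Finset.mul_sum, ← Finset.mul_sum,
    ← zdot, ← zsgnDot]
  simp [cdelta]
  ring

lemma sum_csgn_mul_csgn {i j : Fin n} (h : i ≠ j) (y : ZSp n) :
    ∑ r : Fin n, csgn (((r : ℕ) : ℤ) - ((j : ℕ) : ℤ)) * csgn (((i : ℕ) : ℤ) - ((r : ℕ) : ℤ))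
        * (y.1 r * y.2 r) =
      -zdot y - csgn (((i : ℕ) : ℤ) - ((j : ℕ) : ℤ)) * (zsgnDot i y - zsgnDot j y) := by
  have hij : ((i : ℕ) : ℤ) ≠ ((j : ℕ) : ℤ) := by
    simpa [Fin.val_inj] using h
  rw [zsgnDot, zsgnDot, ← Finset.sum_sub_distrib, zdot, ← Finset.sum_neg_distrib, Finset.mul_sum,
    ← Finset.sum_sub_distrib]
  refine Finset.sum_congr rfl fun r _ => ?_
  linear_combination (y.1 r * y.2 r) * csgn_triple hij ((r : ℕ) : ℤ)

lemma fderiv_zsgnDot_coordHam_inl {i j : Fin n} (h : i ≠ j) (y : ZSp n) :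
    fderiv ℂ (zsgnDot j) y (coordHam (zdir n) (zbiv n κ F G) (.inl i) y) =
      κ / 2 * y.1 i * (-zdot y + csgn (((i : ℕ) : ℤ) - ((j : ℕ) : ℤ)) * (F (zdot y) + zsgnDot j y)
        - G (zdot y) * zsgnDot j y) := by
  have e : ∀ r : Fin n, csgn (((r : ℕ) : ℤ) - ((j : ℕ) : ℤ)) *
        (zaa n κ y i r * y.2 r + y.1 r * zab n κ F G y i r) =
      κ / 2 * (y.1 i * (csgn (((r : ℕ) : ℤ) - ((j : ℕ) : ℤ))
          * csgn (((i : ℕ) : ℤ) - ((r : ℕ) : ℤ)) * (y.1 r * y.2 r))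
        + cdelta i r * (csgn (((r : ℕ) : ℤ) - ((j : ℕ) : ℤ)) * y.1 r * (F (zdot y) + zsgnDot i y))
        - y.1 i * G (zdot y) * (csgn (((r : ℕ) : ℤ) - ((j : ℕ) : ℤ)) * y.1 r * y.2 r)) := by
    intro r
    rw [zab_eq, zaa]
    ring
  rw [fderiv_zsgnDot, coordHam_inl, Finset.sum_congr rfl fun r _ => e r, ← Finset.mul_sum,
    Finset.sum_sub_distrib, Finset.sum_add_distrib, ← Finset.mul_sum, ← Finset.mul_sum,
    sum_csgn_mul_csgn h, ← zsgnDot]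
  simp [cdelta]
  ring

lemma fderiv_zsgnDot_coordHam_inr {l j : Fin n} (h : l ≠ j) (y : ZSp n) :
    fderiv ℂ (zsgnDot j) y (coordHam (zdir n) (zbiv n κ F G) (.inr l) y) =
      -(κ / 2 * y.2 l * (-zdot y + csgn (((l : ℕ) : ℤ) - ((j : ℕ) : ℤ))
        * (F (zdot y) + zsgnDot j y) - G (zdot y) * zsgnDot j y)) := by
  have e : ∀ r : Fin n, csgn (((r : ℕ) : ℤ) - ((j : ℕ) : ℤ)) *
        (-zab n κ F G y r l * y.2 r + y.1 r * zbb n κ y l r) =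
      κ / 2 * (-y.2 l * (csgn (((r : ℕ) : ℤ) - ((j : ℕ) : ℤ))
          * csgn (((l : ℕ) : ℤ) - ((r : ℕ) : ℤ)) * (y.1 r * y.2 r))
        - cdelta r l * (csgn (((r : ℕ) : ℤ) - ((j : ℕ) : ℤ)) * y.2 r * (F (zdot y) + zsgnDot r y))
        + y.2 l * G (zdot y) * (csgn (((r : ℕ) : ℤ) - ((j : ℕ) : ℤ)) * y.1 r * y.2 r)) := by
    intro r
    rw [zab_eq, zbb]
    ring
  rw [fderiv_zsgnDot, coordHam_inr, Finset.sum_congr rfl fun r _ => e r, ← Finset.mul_sum,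
    Finset.sum_add_distrib, Finset.sum_sub_distrib, ← Finset.mul_sum, ← Finset.mul_sum,
    sum_csgn_mul_csgn h, ← zsgnDot]
  simp [cdelta]
  ring

lemma coordJacobiator_inl_inl_inl (i j k : Fin n) (y : ZSp n) :
    coordJacobiator (zdir n) (zbiv n κ F G) (.inl i) (.inl j) (.inl k) y = 0 := by
  simp only [coordJacobiator, fderiv_zbiv_inl_inl, coordHam_inl, zaa]
  rw [csgn_swap ((j : ℕ) : ℤ) ((i : ℕ) : ℤ), csgn_swap ((k : ℕ) : ℤ) ((j : ℕ) : ℤ),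
    csgn_swap ((k : ℕ) : ℤ) ((i : ℕ) : ℤ)]
  ring

lemma coordJacobiator_inr_inr_inr (i j k : Fin n) (y : ZSp n) :
    coordJacobiator (zdir n) (zbiv n κ F G) (.inr i) (.inr j) (.inr k) y = 0 := by
  simp only [coordJacobiator, fderiv_zbiv_inr_inr, coordHam_inr, zbb]
  rw [csgn_swap ((j : ℕ) : ℤ) ((i : ℕ) : ℤ), csgn_swap ((k : ℕ) : ℤ) ((j : ℕ) : ℤ),
    csgn_swap ((k : ℕ) : ℤ) ((i : ℕ) : ℤ)]
  ring

/-- The failure `F F' + G (F - F' t) - t` of the Jacobi condition. -/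
def zdefect (F G : ℂ → ℂ) (t : ℂ) : ℂ :=
  F t * deriv F t + G t * (F t - deriv F t * t) - t

lemma cdelta_self {K : Type*} [DecidableEq K] (i : K) : cdelta i i = 1 := if_pos rfl

lemma cdelta_of_ne {K : Type*} [DecidableEq K] {i j : K} (h : i ≠ j) : cdelta i j = 0 := if_neg h

lemma coordJacobiator_inl_inl_inr (hF : Differentiable ℂ F) (hG : Differentiable ℂ G)
    {i j : Fin n} (h : i ≠ j) (l : Fin n) (y : ZSp n) :
    coordJacobiator (zdir n) (zbiv n κ F G) (.inl i) (.inl j) (.inr l) y =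
      (κ / 2) ^ 2 * (cdelta j l * y.1 i - cdelta i l * y.1 j) * zdefect F G (zdot y) := by
  have hs := csgn_swap ((j : ℕ) : ℤ) ((i : ℕ) : ℤ)
  simp only [coordJacobiator, fderiv_zbiv_inr_inl, fderiv_zbiv_inl_inr hF hG, fderiv_zbiv_inl_inl,
    fderiv_zdot_coordHam_inl, fderiv_zsgnDot_coordHam_inl h, fderiv_zsgnDot_coordHam_inl h.symm]
  simp only [coordHam_inl, coordHam_inr, zaa, zab_eq, hs, zdefect]
  ring

lemma coordJacobiator_inl_inl_inr_self (i l : Fin n) (y : ZSp n) :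
    coordJacobiator (zdir n) (zbiv n κ F G) (.inl i) (.inl i) (.inr l) y = 0 := by
  simp only [coordJacobiator, fderiv_zbiv_inr_inl, fderiv_zbiv_inl_inl, csgn_self]
  ring

lemma coordJacobiator_inl_inr_inr (hF : Differentiable ℂ F) (hG : Differentiable ℂ G)
    {j l : Fin n} (h : j ≠ l) (i : Fin n) (y : ZSp n) :
    coordJacobiator (zdir n) (zbiv n κ F G) (.inl i) (.inr j) (.inr l) y =
      (κ / 2) ^ 2 * (cdelta i l * y.2 j - cdelta i j * y.2 l) * zdefect F G (zdot y) := by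
  have hs := csgn_swap ((l : ℕ) : ℤ) ((j : ℕ) : ℤ)
  simp only [coordJacobiator, fderiv_zbiv_inr_inl, fderiv_zbiv_inl_inr hF hG, fderiv_zbiv_inr_inr,
    fderiv_zdot_coordHam_inr, zdefect]
  rcases eq_or_ne i l with rfl | hil
  · simp only [fderiv_zsgnDot_coordHam_inr h]
    simp only [coordHam_inl, coordHam_inr, zbb, zab_eq, cdelta_self, cdelta_of_ne h.symm, hs]
    ring
  rcases eq_or_ne i j with rfl | hij
  · simp only [fderiv_zsgnDot_coordHam_inr h.symm]
    simp only [coordHam_inl, coordHam_inr, zbb, zab_eq, cdelta_self, cdelta_of_ne h, hs]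
    ring
  simp only [coordHam_inl, coordHam_inr, zbb, zab_eq, cdelta_of_ne hil, cdelta_of_ne hij, hs]
  ring

lemma coordJacobiator_inl_inr_inr_self (i l : Fin n) (y : ZSp n) :
    coordJacobiator (zdir n) (zbiv n κ F G) (.inl i) (.inr l) (.inr l) y = 0 := by
  simp only [coordJacobiator, fderiv_zbiv_inr_inl, fderiv_zbiv_inr_inr, csgn_self]
  ring

lemma coordJacobiator_eq_zero (hF : Differentiable ℂ F) (hG : Differentiable ℂ G) {y : ZSp n}
    (hy : Nontrivial (Fin n) → zdefect F G (zdot y) = 0) (α β γ : Fin n ⊕ Fin n) :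
    coordJacobiator (zdir n) (zbiv n κ F G) α β γ y = 0 := by
  have haab : ∀ i j l : Fin n,
      coordJacobiator (zdir n) (zbiv n κ F G) (.inl i) (.inl j) (.inr l) y = 0 := by
    intro i j l
    rcases eq_or_ne i j with rfl | h
    · exact coordJacobiator_inl_inl_inr_self i l y
    · rw [coordJacobiator_inl_inl_inr hF hG h, hy ⟨i, j, h⟩, mul_zero]
  have habb : ∀ i j l : Fin n,
      coordJacobiator (zdir n) (zbiv n κ F G) (.inl i) (.inr j) (.inr l) y = 0 := by
    intro i j l
    rcases eq_or_ne j l with rfl | h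
    · exact coordJacobiator_inl_inr_inr_self i j y
    · rw [coordJacobiator_inl_inr_inr hF hG h, hy ⟨j, l, h⟩, mul_zero]
  rcases α with i | i <;> rcases β with j | j <;> rcases γ with k | k
  · exact coordJacobiator_inl_inl_inl i j k y
  · exact haab i j k
  · rw [coordJacobiator_cycle, coordJacobiator_cycle]
    exact haab k i j
  · exact habb i j k
  · rw [coordJacobiator_cycle]
    exact haab j k i
  · rw [coordJacobiator_cycle]
    exact habb j k i
  · rw [coordJacobiator_cycle, coordJacobiator_cycle]
    exact habb k i j
  · exact coordJacobiator_inr_inr_inr i j k y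

lemma brZ_jacobi (hF : Differentiable ℂ F) (hG : Differentiable ℂ G) {F₁ F₂ F₃ : ZSp n → ℂ}
    (h₁ : ContDiff ℂ 2 F₁) (h₂ : ContDiff ℂ 2 F₂) (h₃ : ContDiff ℂ 2 F₃) {y : ZSp n}
    (hy : Nontrivial (Fin n) → zdefect F G (zdot y) = 0) :
    brZ n κ F G F₁ (brZ n κ F G F₂ F₃) y + brZ n κ F G F₂ (brZ n κ F G F₃ F₁) y
      + brZ n κ F G F₃ (brZ n κ F G F₁ F₂) y = 0 := by
  simp only [brZ_eq_bivectorBracket]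
  rw [bivectorBracket_jacobiator (differentiable_zbiv hF hG) zbiv_antisymm h₁ h₂ h₃]
  simp [coordJacobiator_eq_zero hF hG hy]

/-- The Jacobiator of the coordinate functions `a_i`, `a_j`, `b_j` for `i ≠ j`. -/
lemma brZ_jacobiator_coords (hF : Differentiable ℂ F) (hG : Differentiable ℂ G)
    {i j : Fin n} (h : i ≠ j) (y : ZSp n) :
    brZ n κ F G (fun z => z.1 i) (brZ n κ F G (fun z => z.1 j) (fun z => z.2 j)) y
      + brZ n κ F G (fun z => z.1 j) (brZ n κ F G (fun z => z.2 j) (fun z => z.1 i)) y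
      + brZ n κ F G (fun z => z.2 j) (brZ n κ F G (fun z => z.1 i) (fun z => z.1 j)) y =
      (κ / 2) ^ 2 * y.1 i * zdefect F G (zdot y) := by
  simp only [brZ_eq_bivectorBracket]
  rw [bivectorBracket_jacobiator (differentiable_zbiv hF hG) zbiv_antisymm (by fun_prop)
    (by fun_prop) (by fun_prop)]
  simp only [(hasFDerivAt_fst_apply _ y).fderiv, (hasFDerivAt_snd_apply _ y).fderiv]
  simp [Fintype.sum_sum_type, zdir_inl, zdir_inr, za, zb, Pi.single_apply,
    coordJacobiator_inl_inl_inr hF hG h, cdelta_self, cdelta_of_ne h]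

end Zakrzewski

/-- the Zakrzewski-type bracket always satisfies the Jacobi identity for `n = 1`,
and for `n ≥ 2` it satisfies the Jacobi identity iff `FF' + G(F − F't) = t`. -/
theorem statement17 (n : ℕ) (κ : ℂ) (hκ : κ ≠ 0)
    (F G : ℂ → ℂ) (hF : Differentiable ℂ F) (hG : Differentiable ℂ G) :
    (n = 1 →
      ∀ F₁ F₂ F₃ : ZSp n → ℂ, ContDiff ℂ 2 F₁ → ContDiff ℂ 2 F₂ → ContDiff ℂ 2 F₃ →
        ∀ y : ZSp n,
          brZ n κ F G F₁ (brZ n κ F G F₂ F₃) y + brZ n κ F G F₂ (brZ n κ F G F₃ F₁) y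
            + brZ n κ F G F₃ (brZ n κ F G F₁ F₂) y = 0) ∧
    (2 ≤ n →
      ((∀ F₁ F₂ F₃ : ZSp n → ℂ, ContDiff ℂ 2 F₁ → ContDiff ℂ 2 F₂ → ContDiff ℂ 2 F₃ →
        ∀ y : ZSp n,
          brZ n κ F G F₁ (brZ n κ F G F₂ F₃) y + brZ n κ F G F₂ (brZ n κ F G F₃ F₁) y
            + brZ n κ F G F₃ (brZ n κ F G F₁ F₂) y = 0) ↔
        ∀ t : ℂ, F t * deriv F t + G t * (F t - deriv F t * t) = t)) := by
  have hiff : ∀ t, F t * deriv F t + G t * (F t - deriv F t * t) = t ↔ zdefect F G t = 0 :=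
    fun t => sub_eq_zero.symm
  refine ⟨?_, fun hn => ⟨fun hJ t => ?_, fun h F₁ F₂ F₃ h₁ h₂ h₃ y => ?_⟩⟩
  · rintro rfl F₁ F₂ F₃ h₁ h₂ h₃ y
    exact brZ_jacobi hF hG h₁ h₂ h₃ fun hnt => absurd hnt (not_nontrivial _)
  · have hij : (⟨0, by omega⟩ : Fin n) ≠ ⟨1, by omega⟩ := by simp
    generalize (⟨0, by omega⟩ : Fin n) = i at hij
    generalize (⟨1, by omega⟩ : Fin n) = j at hij
    have hdot : zdot ((Pi.single i 1, Pi.single i t) : ZSp n) = t := by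
      simp [zdot, Pi.single_apply]
    have h0 := hJ (fun z => z.1 i) (fun z => z.1 j) (fun z => z.2 j) (by fun_prop) (by fun_prop)
      (by fun_prop) (Pi.single i 1, Pi.single i t)
    rw [brZ_jacobiator_coords hF hG hij, hdot] at h0
    rw [hiff]
    simpa [hκ] using h0
  · exact brZ_jacobi hF hG h₁ h₂ h₃ fun _ => (hiff _).1 (h _)
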